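/- Let N_k ⇒_LI N_{k+1} be a Linear transformation with N_k = N ∪ {Γ → E[x]_{p,q}} and N_{k+1} = N ∪ {Γ{x ↦ x'}, Γ → E[x']_q}, and let N⊥_{k+1} be a conflicting core of N_{k+1}. If for every clause (Γ{x ↦ x'}, Γ → E[x']_q)σ_j ∈ N⊥_{k+1} (1 ≤ j ≤ m) we have xσ_j = x'σ_j, then (N⊥_{k+1} \ {(Γ{x ↦ x'}, Γ → E[x']_q)σ_j | 1 ≤ j ≤ m}) ∪ {(Γ → E[x]_{p,q})σ_j | 1 ≤ j ≤ m} is a conflicting core of N_k. -/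

import Mathlib

namespace FOApprox

/-- First-order terms over a countable signature of function symbols. -/
inductive Tm : Type where
  | var : ℕ → Tm
  | fn : ℕ → List Tm → Tm

/-- Atoms: a predicate symbol applied to a list of terms. -/
structure Atom : Type where
  pred : ℕ
  args : List Tm

/-- Substitutions map variables to terms. -/
abbrev Subst := ℕ → Tm

mutual
/-- Application of a substitution to a term. -/
def Tm.subst (σ : Subst) : Tm → Tm
  | .var x => σ x
  | .fn f ts => .fn f (Tm.substList σ ts)
def Tm.substList (σ : Subst) : List Tm → List Tm
  | [] => []
  | t :: ts => Tm.subst σ t :: Tm.substList σ ts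
end

def Atom.subst (σ : Subst) (A : Atom) : Atom := ⟨A.pred, Tm.substList σ A.args⟩

/-- A clause Γ → Δ: `neg` is the multiset Γ of negative atoms,
`pos` the multiset Δ of positive atoms. -/
structure Clause : Type where
  neg : Multiset Atom
  pos : Multiset Atom

def Clause.subst (σ : Subst) (C : Clause) : Clause :=
  ⟨C.neg.map (Atom.subst σ), C.pos.map (Atom.subst σ)⟩

/-- A term is ground if it is invariant under all substitutions. -/
def Tm.Ground (t : Tm) : Prop := ∀ σ : Subst, t.subst σ = t

def Clause.Ground (C : Clause) : Prop := ∀ σ : Subst, C.subst σ = C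

/-- A grounding substitution maps every variable to a ground term. -/
def Subst.Grounding (σ : Subst) : Prop := ∀ x, (σ x).Ground

/-- A Herbrand interpretation `I` (a set of ground atoms) satisfies a clause
Γ → Δ if for every grounding substitution σ, Δσ ∩ I ≠ ∅ or Γσ ⊄ I. -/
def SatClause (I : Set Atom) (C : Clause) : Prop :=
  ∀ σ : Subst, σ.Grounding →
    (∃ A ∈ C.pos, A.subst σ ∈ I) ∨ (∃ A ∈ C.neg, A.subst σ ∉ I)

def Models (I : Set Atom) (N : Set Clause) : Prop := ∀ C ∈ N, SatClause I C

def Satisfiable (N : Set Clause) : Prop := ∃ I : Set Atom, Models I N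

/-- Apply a substitution to all clauses of a set (variables are shared). -/
def SubstSet (σ : Subst) (N : Set Clause) : Set Clause := Clause.subst σ '' N

/-- A finite clause set is a conflicting core if all its simultaneous ground
instances are unsatisfiable. -/
def ConflictingCore (Nb : Set Clause) : Prop :=
  Nb.Finite ∧ ∀ τ : Subst, τ.Grounding → ¬ Satisfiable (SubstSet τ Nb)

/-- `Nb` is a conflicting core of `N`: additionally every clause of `Nb`
is an instance of a clause of `N`. -/
def ConflictingCoreOf (Nb N : Set Clause) : Prop :=
  ConflictingCore Nb ∧ ∀ C ∈ Nb, ∃ C' ∈ N, ∃ σ : Subst, C = Clause.subst σ C'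

/-- An atom occurs (positively or negatively) in a clause. -/
def AtomIn (A : Atom) (C : Clause) : Prop := A ∈ C.neg ∨ A ∈ C.pos

mutual
def Tm.fns : Tm → List ℕ
  | .var _ => []
  | .fn f ts => f :: Tm.fnsList ts
def Tm.fnsList : List Tm → List ℕ
  | [] => []
  | t :: ts => Tm.fns t ++ Tm.fnsList ts
end

mutual
def Tm.vars : Tm → List ℕ
  | .var x => [x]
  | .fn _ ts => Tm.varsList ts
def Tm.varsList : List Tm → List ℕ
  | [] => []
  | t :: ts => Tm.vars t ++ Tm.varsList ts
end

def VarInClause (x : ℕ) (C : Clause) : Prop :=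
  ∃ A, AtomIn A C ∧ ∃ t ∈ A.args, x ∈ Tm.vars t

def FnInClause (f : ℕ) (C : Clause) : Prop :=
  ∃ A, AtomIn A C ∧ ∃ t ∈ A.args, f ∈ Tm.fns t

def PredInClause (P : ℕ) (C : Clause) : Prop := ∃ A, AtomIn A C ∧ A.pred = P

def PredIn (P : ℕ) (N : Set Clause) : Prop := ∃ C ∈ N, PredInClause P C

def PredNotIn (P : ℕ) (N : Set Clause) : Prop := ∀ C ∈ N, ¬ PredInClause P C

def FnNotIn (f : ℕ) (N : Set Clause) : Prop := ∀ C ∈ N, ¬ FnInClause f C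

def VarNotInClause (x : ℕ) (C : Clause) : Prop := ¬ VarInClause x C

/-- Subterm of a term at a position. -/
def Tm.atPos : List ℕ → Tm → Option Tm
  | [], t => some t
  | _ :: _, .var _ => none
  | i :: p, .fn _ ts => (ts[i]?).bind (Tm.atPos p)

/-- Replace the subterm at a position in a term. -/
def Tm.replaceAt : List ℕ → Tm → Tm → Option Tm
  | [], _, u => some u
  | _ :: _, .var _, _ => none
  | i :: p, .fn f ts, u =>
    (ts[i]?).bind fun t => (Tm.replaceAt p t u).map fun t' => Tm.fn f (ts.set i t')

/-- Subterm of an atom at a position: the head of the position selects an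
argument, the tail a position inside that argument. A position of length 1
is a top position. -/
def Atom.atPos (A : Atom) : List ℕ → Option Tm
  | [] => none
  | i :: p => (A.args[i]?).bind (Tm.atPos p)

def Atom.replaceAt (A : Atom) : List ℕ → Tm → Option Atom
  | [], _ => none
  | i :: p, u =>
    (A.args[i]?).bind fun t =>
      (Tm.replaceAt p t u).map fun t' => ⟨A.pred, A.args.set i t'⟩

/-- A complex term is a non-variable term. -/
def Tm.Complex : Tm → Prop
  | .var _ => False
  | .fn _ _ => True

mutual
/-- Skeleton computation with a fresh-variable counter. -/
def Tm.sktAux : Tm → ℕ → Tm × ℕ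
  | .var _, n => (.var n, n + 1)
  | .fn f ts, n =>
    let r := Tm.sktAuxList ts n
    (.fn f r.1, r.2)
def Tm.sktAuxList : List Tm → ℕ → List Tm × ℕ
  | [], n => ([], n)
  | t :: ts, n =>
    let r := Tm.sktAux t n
    let r' := Tm.sktAuxList ts r.2
    (r.1 :: r'.1, r'.2)
end

/-- The term skeleton: every variable occurrence is replaced by a distinct
fresh variable. -/
def Tm.skeleton (t : Tm) : Tm := (Tm.sktAux t 0).1

/-- The projection μ_P on atoms: replaces P(t₁,…,tₙ) by T(f_P(t₁,…,tₙ)). -/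
def projAtom (P T f : ℕ) (A : Atom) : Atom :=
  if A.pred = P then ⟨T, [Tm.fn f A.args]⟩ else A

def projClause (P T f : ℕ) (C : Clause) : Clause :=
  ⟨C.neg.map (projAtom P T f), C.pos.map (projAtom P T f)⟩

def projSet (P T f : ℕ) (N : Set Clause) : Set Clause := projClause P T f '' N

/-- The reverse projection μ_P⁻¹ on Herbrand interpretations. -/
def projInvInterp (P T f : ℕ) (I : Set Atom) : Set Atom := projAtom P T f ⁻¹' I

/-- The reverse projection μ_P⁻¹ on atoms: T(f_P(t₁,…,tₙ)) is mapped back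
to P(t₁,…,tₙ), all other atoms are unchanged. -/
def unprojAtom (P T f : ℕ) (A : Atom) : Atom :=
  match A with
  | ⟨Q, [Tm.fn g ts]⟩ => if Q = T ∧ g = f then ⟨P, ts⟩ else ⟨Q, [Tm.fn g ts]⟩
  | A => A

def unprojClause (P T f : ℕ) (C : Clause) : Clause :=
  ⟨C.neg.map (unprojAtom P T f), C.pos.map (unprojAtom P T f)⟩

/-- The substitution {x ↦ x'}. -/
def singleSubst (x x' : ℕ) : Subst := fun y => if y = x then Tm.var x' else Tm.var y

/-- Monadic transformation step (T is the fixed projection predicate,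
`fp P` the projection function symbol for the predicate `P`). -/
def MOStep (T : ℕ) (fp : ℕ → ℕ) (N N' : Set Clause) : Prop :=
  ∃ (P : ℕ) (C C' : Clause) (A : Atom) (M : Multiset Atom),
    C ∈ N ∧ A.pred = P ∧ P ≠ T ∧ 2 ≤ A.args.length ∧
    ((C.neg = A ::ₘ M ∧ C'.neg = (projAtom P T (fp P) A) ::ₘ M ∧ C'.pos = C.pos) ∨
     (C.pos = A ::ₘ M ∧ C'.pos = (projAtom P T (fp P) A) ::ₘ M ∧ C'.neg = C.neg)) ∧
    N' = (N \ {C}) ∪ {C'}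

/-- Horn transformation step: replace Γ → E₁,…,Eₙ (n > 1) by Γ → Eᵢ. -/
def HOStep (N N' : Set Clause) : Prop :=
  ∃ (C : Clause) (E : Atom),
    C ∈ N ∧ E ∈ C.pos ∧ 2 ≤ Multiset.card C.pos ∧
    N' = (N \ {C}) ∪ {⟨C.neg, {E}⟩}

/-- Shallow transformation step: replace Γ₁,Γ₂ → E[s]_p (s complex, p not a
top position) by S(x), Γ₁ → E[x]_p and Γ₂ → S(s), with S, x fresh. -/
def SHStep (N N' : Set Clause) : Prop :=
  ∃ (Γ₁ Γ₂ : Multiset Atom) (E E' : Atom) (p : List ℕ) (s : Tm) (S x : ℕ),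
    (⟨Γ₁ + Γ₂, {E}⟩ : Clause) ∈ N ∧
    E.atPos p = some s ∧ Tm.Complex s ∧ 2 ≤ p.length ∧
    PredNotIn S N ∧ VarNotInClause x ⟨Γ₁ + Γ₂, {E}⟩ ∧
    E.replaceAt p (Tm.var x) = some E' ∧
    N' = (N \ {(⟨Γ₁ + Γ₂, {E}⟩ : Clause)}) ∪
      {(⟨(⟨S, [Tm.var x]⟩ : Atom) ::ₘ Γ₁, {E'}⟩ : Clause),
       (⟨Γ₂, {(⟨S, [s]⟩ : Atom)}⟩ : Clause)}

/-- Linear transformation step: replace Γ → E[x]_{p,q} by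
Γ{x ↦ x'}, Γ → E[x']_q with x' fresh. -/
def LIStep (N N' : Set Clause) : Prop :=
  ∃ (Γ : Multiset Atom) (E E' : Atom) (p q : List ℕ) (x x' : ℕ),
    (⟨Γ, {E}⟩ : Clause) ∈ N ∧ p ≠ q ∧
    E.atPos p = some (Tm.var x) ∧ E.atPos q = some (Tm.var x) ∧
    VarNotInClause x' ⟨Γ, {E}⟩ ∧
    E.replaceAt q (Tm.var x') = some E' ∧
    N' = (N \ {(⟨Γ, {E}⟩ : Clause)}) ∪
      {(⟨Γ.map (Atom.subst (singleSubst x x')) + Γ, {E'}⟩ : Clause)}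

/-- Applicability of the Monadic transformation: a non-monadic atom occurs. -/
def MOApp (N : Set Clause) : Prop := ∃ C ∈ N, ∃ A, AtomIn A C ∧ 2 ≤ A.args.length

/-- Applicability of the Horn transformation: a non-Horn clause occurs. -/
def HOApp (N : Set Clause) : Prop := ∃ C ∈ N, 2 ≤ Multiset.card C.pos

/-- Applicability of the Shallow transformation. -/
def SHApp (N : Set Clause) : Prop :=
  ∃ C ∈ N, ∃ E ∈ C.pos, ∃ (p : List ℕ) (s : Tm),
    E.atPos p = some s ∧ Tm.Complex s ∧ 2 ≤ p.length

/-- Applicability of the Linear transformation. -/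
def LIApp (N : Set Clause) : Prop :=
  ∃ C ∈ N, ∃ E ∈ C.pos, ∃ (p q : List ℕ) (x : ℕ),
    p ≠ q ∧ E.atPos p = some (Tm.var x) ∧ E.atPos q = some (Tm.var x)

/-- The approximation relation ⇒_apr: the union of the four transformations,
Monadic preceding Horn preceding Shallow preceding Linear. -/
def Apr (T : ℕ) (fp : ℕ → ℕ) (N N' : Set Clause) : Prop :=
  MOStep T fp N N' ∨
  (¬ MOApp N ∧ HOStep N N') ∨
  (¬ MOApp N ∧ ¬ HOApp N ∧ SHStep N N') ∨
  (¬ MOApp N ∧ ¬ HOApp N ∧ ¬ SHApp N ∧ LIStep N N')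

/-- Reflexive-transitive closure of ⇒_apr. -/
def AprStar (T : ℕ) (fp : ℕ → ℕ) : Set Clause → Set Clause → Prop :=
  Relation.ReflTransGen (Apr T fp)

/-- Freshness of the projection symbols for a clause set: `fp` is injective,
`T` and the symbols `fp P` do not occur in `N`. -/
def FreshFor (T : ℕ) (fp : ℕ → ℕ) (N : Set Clause) : Prop :=
  Function.Injective fp ∧ PredNotIn T N ∧ ∀ P, FnNotIn (fp P) N

/-- Minimal Herbrand model with respect to set inclusion. -/
def MinimalModel (I : Set Atom) (N : Set Clause) : Prop :=
  Models I N ∧ ∀ J : Set Atom, J ⊂ I → ¬ Models J N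

/-- A clause set is monadic if all predicates have at most one argument. -/
def MonadicSet (N : Set Clause) : Prop :=
  ∀ C ∈ N, ∀ A, AtomIn A C → A.args.length ≤ 1

end FOApprox
namespace FOApprox

/-- Entailment of a clause implication: every Herbrand model of `M`
satisfying `C₁` also satisfies `C₂`. -/
def EntailsClauseImp (M : Set Clause) (C₁ C₂ : Clause) : Prop :=
  ∀ I : Set Atom, Models I M → SatClause I C₁ → SatClause I C₂

/-- The set of unit clauses expressing the negation of a clause. -/
def NegClauses (C : Clause) : Set Clause :=
  {D | ∃ A ∈ C.neg, D = ⟨0, {A}⟩} ∪ {D | ∃ A ∈ C.pos, D = ⟨{A}, 0⟩}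

/-- A substitution is a (variable) renaming. -/
def IsRenaming (σ : Subst) : Prop :=
  (∀ x, ∃ y, σ x = Tm.var y) ∧ Function.Injective σ

/-- The clauses of `N` are pairwise variable disjoint. -/
def PairwiseVarDisjoint (N : Set Clause) : Prop :=
  ∀ C ∈ N, ∀ D ∈ N, C ≠ D → ∀ x, VarInClause x C → ¬ VarInClause x D

/-- `R` is a resolvent on an `S`-literal of two clauses from `Nb`. -/
def SResolvent (S : ℕ) (Nb : Set Clause) (R : Clause) : Prop :=
  ∃ D₁ ∈ Nb, ∃ D₂ ∈ Nb, ∃ (A : Atom) (M₁ M₂ : Multiset Atom),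
    A.pred = S ∧ D₁.neg = A ::ₘ M₁ ∧ D₂.pos = A ::ₘ M₂ ∧
    R = ⟨M₁ + D₂.neg, D₁.pos + M₂⟩

/-- The set of ground instances of clauses of `N`. -/
def GroundInstances (N : Set Clause) : Set Clause :=
  {D | (∃ C ∈ N, ∃ σ : Subst, D = Clause.subst σ C) ∧ D.Ground}

/-- `A` is the strictly maximal atom of `D`, occurring positively. -/
def StrictlyMaxIn (altlt : Atom → Atom → Prop) (A : Atom) (D : Clause) : Prop :=
  ∃ M, D.pos = A ::ₘ M ∧ ∀ B ∈ D.neg + M, altlt B A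

/-- The productive atoms δ_D of a ground clause, defined by well-founded
recursion along the ground clause ordering. -/
noncomputable def delta (Ng : Set Clause) (altlt : Atom → Atom → Prop)
    {clt : Clause → Clause → Prop} (wf : WellFounded clt) : Clause → Set Atom :=
  WellFounded.fix (C := fun _ => Set Atom) wf fun D IH =>
    {A | D ∈ Ng ∧ StrictlyMaxIn altlt A D ∧
      ¬ SatClause (⋃ D', ⋃ (h : clt D' D), IH D' h) D}

/-- The superposition partial minimal model operator I_N. -/
noncomputable def partialModel (N : Set Clause) (altlt : Atom → Atom → Prop)
    {clt : Clause → Clause → Prop} (wf : WellFounded clt) : Set Atom :=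
  ⋃ C ∈ GroundInstances N, delta (GroundInstances N) altlt wf C

/-- The hypothesis of the direct Horn lifting lemma for the Horn step
replacing `C₀` (the non-Horn ancestor) by `C₁`, with conflicting core `Nb`. -/
def DirectHornHyp (Nk : Set Clause) (C₀ C₁ : Clause) (Nb : Set Clause) : Prop :=
  ∃ (m : ℕ) (σ σ' τ : Fin m → Subst) (Nsub : Fin m → Set Clause),
    (∀ j, Clause.subst (σ j) C₁ ∈ Nb) ∧
    (∀ D ∈ Nb, (∃ ρ : Subst, D = Clause.subst ρ C₁) →
      ∃ j, D = Clause.subst (σ j) C₁) ∧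
    (∀ j, Nsub j ⊆ Nk) ∧
    (∀ j, EntailsClauseImp (SubstSet (τ j) (Nsub j))
      (Clause.subst (σ' j) C₀) (Clause.subst (σ j) C₁)) ∧
    (∀ j, ConflictingCore (SubstSet (τ j) (Nsub j) ∪
      {Clause.subst (σ' j) C₀} ∪ NegClauses (Clause.subst (σ j) C₁)))

end FOApprox

namespace FOApprox

theorem Tm.substList_eq_map (σ : Subst) (ts : List Tm) :
    Tm.substList σ ts = ts.map (Tm.subst σ) := by
  induction ts with
  | nil => rfl
  | cons t ts ih => simp [Tm.substList, ih]

/-- Replacing a list entry by one with the same image leaves the mapped list unchanged. -/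
theorem map_set_eq_map {α β : Type*} (f : α → β) {ts : List α} {i : ℕ} {t u : α}
    (ht : ts[i]? = some t) (h : f u = f t) : (ts.set i u).map f = ts.map f := by
  apply List.ext_getElem?
  intro k
  rw [List.map_set, List.getElem?_set]
  split_ifs with hik hlen
  · subst hik
    simp [ht, h]
  · subst hik
    simp only [List.length_map] at hlen
    simp [hlen]
  · rfl

theorem Tm.subst_replaceAt (σ : Subst) {q : List ℕ} {t t' u v : Tm}
    (hq : t.atPos q = some u) (hrep : Tm.replaceAt q t v = some t')
    (huv : v.subst σ = u.subst σ) : t'.subst σ = t.subst σ := by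
  induction q generalizing t t' with
  | nil =>
    simp only [Tm.atPos, Tm.replaceAt, Option.some.injEq] at hq hrep
    rw [← hrep, hq, huv]
  | cons i q ih =>
    cases t with
    | var y => simp [Tm.atPos] at hq
    | fn f ts =>
      simp only [Tm.atPos, Tm.replaceAt, Option.bind_eq_some_iff,
        Option.map_eq_some_iff] at hq hrep
      obtain ⟨s, hs, hsq⟩ := hq
      obtain ⟨r, hr, r', hr', rfl⟩ := hrep
      obtain rfl : s = r := Option.some.inj (hs.symm.trans hr)
      simp only [Tm.subst, Tm.substList_eq_map]
      rw [map_set_eq_map _ hs (ih hsq hr')]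

theorem Atom.subst_replaceAt (σ : Subst) {q : List ℕ} {A A' : Atom} {u v : Tm}
    (hq : A.atPos q = some u) (hrep : A.replaceAt q v = some A')
    (huv : v.subst σ = u.subst σ) : A'.subst σ = A.subst σ := by
  cases q with
  | nil => simp [Atom.atPos] at hq
  | cons i q =>
    simp only [Atom.atPos, Atom.replaceAt, Option.bind_eq_some_iff,
      Option.map_eq_some_iff] at hq hrep
    obtain ⟨s, hs, hsq⟩ := hq
    obtain ⟨r, hr, r', hr', rfl⟩ := hrep
    obtain rfl : s = r := Option.some.inj (hs.symm.trans hr)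
    simp only [Atom.subst, Tm.substList_eq_map]
    rw [map_set_eq_map _ hs (Tm.subst_replaceAt σ hsq hr' huv)]

mutual
theorem Tm.subst_singleSubst {σ : Subst} {x x' : ℕ} (h : σ x = σ x') :
    ∀ t : Tm, (t.subst (singleSubst x x')).subst σ = t.subst σ
  | .var y => by
    by_cases hy : y = x
    · simp [Tm.subst, singleSubst, hy, h]
    · simp [Tm.subst, singleSubst, hy]
  | .fn f ts => by
    simp only [Tm.subst, Tm.substList_singleSubst h ts]
theorem Tm.substList_singleSubst {σ : Subst} {x x' : ℕ} (h : σ x = σ x') :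
    ∀ ts : List Tm,
      Tm.substList σ (Tm.substList (singleSubst x x') ts) = Tm.substList σ ts
  | [] => rfl
  | t :: ts => by
    simp only [Tm.substList, Tm.subst_singleSubst h t, Tm.substList_singleSubst h ts]
end

theorem Atom.subst_singleSubst {σ : Subst} {x x' : ℕ} (h : σ x = σ x') (A : Atom) :
    (A.subst (singleSubst x x')).subst σ = A.subst σ := by
  simp only [Atom.subst, Tm.substList_singleSubst h]

/-- An instance of the linearized clause that identifies `x` and `x'` is the corresponding
instance of the original clause with its negative atoms duplicated. -/
theorem Clause.subst_linear {σ : Subst} {Γ : Multiset Atom} {E E' : Atom} {q : List ℕ}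
    {x x' : ℕ} (hq : E.atPos q = some (Tm.var x))
    (hrep : E.replaceAt q (Tm.var x') = some E') (h : σ x = σ x') :
    Clause.subst σ ⟨Γ.map (Atom.subst (singleSubst x x')) + Γ, {E'}⟩ =
      ⟨Γ.map (Atom.subst σ) + Γ.map (Atom.subst σ), {E.subst σ}⟩ := by
  simp only [Clause.subst, Multiset.map_add, Multiset.map_map, Function.comp_def,
    Atom.subst_singleSubst h, Multiset.map_singleton]
  rw [Atom.subst_replaceAt σ hq hrep h.symm]

theorem SatClause.of_subset {I : Set Atom} {C D : Clause} (hC : SatClause I C)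
    (hneg : C.neg ⊆ D.neg) (hpos : C.pos ⊆ D.pos) : SatClause I D := fun σ hσ =>
  (hC σ hσ).imp (fun ⟨A, hA, hI⟩ => ⟨A, hpos hA, hI⟩) fun ⟨A, hA, hI⟩ => ⟨A, hneg hA, hI⟩

/-- Lifting the Linear transformation for conflicting
cores. -/
theorem linear_core_lifting (N : Set Clause) (Γ : Multiset Atom) (E E' : Atom)
    (p q : List ℕ) (x x' : ℕ) (hpq : p ≠ q)
    (hp : E.atPos p = some (Tm.var x)) (hq : E.atPos q = some (Tm.var x))
    (hx' : VarNotInClause x' ⟨Γ, {E}⟩)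
    (hrep : E.replaceAt q (Tm.var x') = some E')
    (Nb : Set Clause)
    (hcore : ConflictingCoreOf Nb
      (N ∪ {(⟨Γ.map (Atom.subst (singleSubst x x')) + Γ, {E'}⟩ : Clause)}))
    (m : ℕ) (σ : Fin m → Subst)
    (hmem : ∀ j, Clause.subst (σ j)
      (⟨Γ.map (Atom.subst (singleSubst x x')) + Γ, {E'}⟩ : Clause) ∈ Nb)
    (hall : ∀ D ∈ Nb,
      (∃ ρ : Subst, D = Clause.subst ρ
        (⟨Γ.map (Atom.subst (singleSubst x x')) + Γ, {E'}⟩ : Clause)) →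
      ∃ j, D = Clause.subst (σ j)
        (⟨Γ.map (Atom.subst (singleSubst x x')) + Γ, {E'}⟩ : Clause))
    (heq : ∀ j, σ j x = σ j x') :
    ConflictingCoreOf
      ((Nb \ (Set.range fun j => Clause.subst (σ j)
          (⟨Γ.map (Atom.subst (singleSubst x x')) + Γ, {E'}⟩ : Clause))) ∪
        (Set.range fun j => Clause.subst (σ j) (⟨Γ, {E}⟩ : Clause)))
      (N ∪ {(⟨Γ, {E}⟩ : Clause)}) := by
  obtain ⟨⟨hfin, hunsat⟩, hinst⟩ := hcore
  refine ⟨⟨hfin.sdiff.union (Set.finite_range _), ?_⟩, ?_⟩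
  · rintro τ hτ ⟨I, hI⟩
    refine hunsat τ hτ ⟨I, ?_⟩
    rintro _ ⟨D, hD, rfl⟩
    by_cases hr : D ∈ Set.range fun j => Clause.subst (σ j)
        (⟨Γ.map (Atom.subst (singleSubst x x')) + Γ, {E'}⟩ : Clause)
    · obtain ⟨j, rfl⟩ := hr
      beta_reduce
      rw [Clause.subst_linear hq hrep (heq j)]
      refine (hI _ ⟨_, Or.inr ⟨j, rfl⟩, rfl⟩).of_subset ?_ ?_
      · simp only [Clause.subst, Multiset.map_add]
        exact Multiset.subset_of_le (Multiset.le_add_right _ _)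
      · simp only [Clause.subst, Multiset.map_singleton]
        exact Multiset.Subset.refl _
    · exact hI _ ⟨D, Or.inl ⟨hD, hr⟩, rfl⟩
  · rintro D (⟨hD, hr⟩ | ⟨j, rfl⟩)
    · obtain ⟨C, hC | rfl, ρ, hρ⟩ := hinst D hD
      · exact ⟨C, Or.inl hC, ρ, hρ⟩
      · obtain ⟨j, hj⟩ := hall D hD ⟨ρ, hρ⟩
        exact absurd ⟨j, hj.symm⟩ hr
    · exact ⟨_, Or.inr rfl, σ j, rfl⟩

end FOApprox
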